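/- arXiv:0811.1733 — 2 statements merged into one kernel-verified Lean document; each statement's English description precedes it below -/
import Mathlib

section
/- For all nonnegative integers p, q, the ratio A_{p,q}(i,j)/A_{0,0}(p+i, q+j) tends to 1/(p+q+1)! as both i and j tend to infinity: for every ε > 0 there exists M such that |A_{p,q}(i,j)/A_{0,0}(p+i, q+j) − 1/(p+q+1)!| < ε whenever i ≥ M and j ≥ M. -/
/-- The generalized Eulerian number `eulerA p q i j` counts the paths in the Euler graph
from `(p, q)` to `(p + i, q + j)`.  It is defined by the initial conditions
`eulerA p q i 0 = (q+1)^i`, `eulerA p q 0 j = (p+1)^j` and the recurrence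
`eulerA p q i j = (j+q+1) * eulerA p q (i-1) j + (i+p+1) * eulerA p q i (j-1)`. -/
def eulerA (p q : ℕ) : ℕ → ℕ → ℕ
  | i, 0 => (q + 1) ^ i
  | 0, j + 1 => (p + 1) ^ (j + 1)
  | i + 1, j + 1 =>
      (j + 1 + q + 1) * eulerA p q i (j + 1) + (i + 1 + p + 1) * eulerA p q (i + 1) j

lemma eulerA_i0 (p q i : ℕ) : eulerA p q i 0 = (q + 1) ^ i := by
  cases i <;> simp [eulerA]

lemma eulerA_0j (p q j : ℕ) : eulerA p q 0 j = (p + 1) ^ j := by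
  cases j <;> simp [eulerA]

lemma eulerA_ss (p q i j : ℕ) : eulerA p q (i + 1) (j + 1) =
    (j + 1 + q + 1) * eulerA p q i (j + 1) + (i + 1 + p + 1) * eulerA p q (i + 1) j := by
  rw [eulerA]

lemma eulerA_pos (p q i j : ℕ) : 0 < eulerA p q i j := by
  induction i generalizing j with
  | zero => rw [eulerA_0j]; positivity
  | succ i ih =>
    cases j with
    | zero => rw [eulerA_i0]; positivity
    | succ j =>
      rw [eulerA_ss]
      have := ih (j + 1)
      positivity

/-- Decomposition of paths according to the first step. -/
lemma eulerA_first (p q i j : ℕ) : eulerA p q (i + 1) (j + 1) =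
    (q + 1) * eulerA (p + 1) q i (j + 1) + (p + 1) * eulerA p (q + 1) (i + 1) j := by
  induction i generalizing j with
  | zero =>
    induction j with
    | zero => simp [eulerA_ss, eulerA_i0, eulerA_0j]; ring
    | succ j ih =>
      rw [eulerA_ss p q, ih, eulerA_ss p (q + 1)]
      simp only [eulerA_0j]
      ring
  | succ i ihi =>
    induction j with
    | zero =>
      rw [eulerA_ss p q, ihi, eulerA_ss (p + 1) q]
      simp only [eulerA_i0]
      ring
    | succ j ihj =>
      rw [eulerA_ss p q, ihj, ihi, eulerA_ss p (q + 1) (i + 1) j, eulerA_ss (p + 1) q i (j + 1)]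
      ring

/-- Exchange identity. -/
lemma eulerA_exch (p q i j : ℕ) :
    (eulerA p (q + 1) (i + 1) j : ℝ) - eulerA (p + 1) q i (j + 1) =
      eulerA p q (i + 1) j - eulerA p q i (j + 1) := by
  induction i generalizing j with
  | zero =>
    induction j with
    | zero => simp [eulerA_i0, eulerA_0j]
    | succ j ih =>
      rw [eulerA_ss p q, eulerA_ss p (q + 1)]
      simp only [eulerA_0j] at *
      push_cast at *
      linear_combination ((p : ℝ) + 2) * ih
  | succ i ihi =>
    induction j with
    | zero =>
      have h := ihi 0
      rw [eulerA_ss p q, eulerA_ss (p + 1) q]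
      simp only [eulerA_i0] at *
      push_cast at *
      linear_combination ((q : ℝ) + 2) * h
    | succ j ihj =>
      have h := ihi (j + 1)
      rw [eulerA_ss p (q + 1) (i + 1) j, eulerA_ss (p + 1) q i (j + 1),
        eulerA_ss p q (i + 1) j, eulerA_ss p q i (j + 1)]
      push_cast at *
      linear_combination ((j : ℝ) + q + 3) * h + ((i : ℝ) + p + 3) * ihj

lemma eulerA_diff (p q i j K : ℕ) (hi : K ≤ i) (hj : K ≤ j) :
    ((K : ℝ) + 1) * |(eulerA p (q + 1) (i + 1) j : ℝ) - eulerA (p + 1) q i (j + 1)| ≤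
      eulerA p q (i + 1) (j + 1) := by
  rw [eulerA_exch, eulerA_ss p q i j]
  push_cast
  have hi' : (K : ℝ) ≤ i := by exact_mod_cast hi
  have hj' : (K : ℝ) ≤ j := by exact_mod_cast hj
  generalize (eulerA p q (i + 1) j) = a
  generalize (eulerA p q i (j + 1)) = b
  have ha : (0 : ℝ) ≤ a := by positivity
  have hb : (0 : ℝ) ≤ b := by positivity
  have hp : (0 : ℝ) ≤ p := by positivity
  have hq : (0 : ℝ) ≤ q := by positivity
  have hK : (0 : ℝ) ≤ K := by positivity
  have h1 : |(a : ℝ) - b| ≤ a + b := by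
    rw [abs_le]; constructor <;> linarith
  calc ((K : ℝ) + 1) * |(a : ℝ) - b| ≤ (K + 1) * (a + b) := by gcongr
    _ = (K + 1) * b + (K + 1) * a := by ring
    _ ≤ _ := by
      gcongr <;> linarith

noncomputable def eulerH (p q i j : ℕ) : ℝ :=
  (eulerA p q i j : ℝ) / (eulerA 0 0 (p + i) (q + j))

lemma eulerH_facts (p q i j K : ℕ) (hi : K ≤ i) (hj : K ≤ j) :
    eulerH p q (i + 1) (j + 1) = (q + 1) * eulerH (p + 1) q i (j + 1)
      + (p + 1) * eulerH p (q + 1) (i + 1) j ∧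
    ((K : ℝ) + 1) * |eulerH p (q + 1) (i + 1) j - eulerH (p + 1) q i (j + 1)| ≤
      eulerH p q (i + 1) (j + 1) := by
  unfold eulerH
  have e1 : p + 1 + i = p + (i + 1) := by ring
  have e2 : q + 1 + j = q + (j + 1) := by ring
  rw [e1, e2]
  have hE : (0 : ℝ) < eulerA 0 0 (p + (i + 1)) (q + (j + 1)) := by
    exact_mod_cast eulerA_pos _ _ _ _
  constructor
  · rw [eulerA_first]; push_cast; ring
  · rw [← sub_div, abs_div, abs_of_pos hE, ← mul_div_assoc]
    gcongr
    exact eulerA_diff p q i j K hi hj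

def eulerP (p q : ℕ) (c : ℝ) : Prop :=
  ∀ ε : ℝ, 0 < ε → ∃ M : ℕ, ∀ i j : ℕ, M ≤ i → M ≤ j → |eulerH p q i j - c| < ε

lemma eulerP_core (p q : ℕ) (c : ℝ) (h : eulerP p q c) (ε : ℝ) (hε : 0 < ε) :
    ∃ M : ℕ, ∀ i j : ℕ, M ≤ i → M ≤ j →
      |eulerH (p + 1) q i (j + 1) - c / (p + q + 2)| < ε ∧
      |eulerH p (q + 1) (i + 1) j - c / (p + q + 2)| < ε := by
  obtain ⟨M₁, h₁⟩ := h (min (ε / 2) 1) (by positivity)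
  obtain ⟨K, hK⟩ := exists_nat_gt (((p : ℝ) + q + 2) * (|c| + 1) / (ε / 2))
  refine ⟨max M₁ K, fun i j hi hj => ?_⟩
  obtain ⟨f1, f2⟩ := eulerH_facts p q i j K (by omega) (by omega)
  have h2 := h₁ (i + 1) (j + 1) (by omega) (by omega)
  have h3 := lt_of_lt_of_le h2 (min_le_left _ _)
  have h4 := lt_of_lt_of_le h2 (min_le_right _ _)
  generalize eulerH p q (i + 1) (j + 1) = x at *
  generalize eulerH (p + 1) q i (j + 1) = y at *
  generalize eulerH p (q + 1) (i + 1) j = z at *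
  have hp : (0 : ℝ) ≤ p := by positivity
  have hq : (0 : ℝ) ≤ q := by positivity
  have hs : (0 : ℝ) < (p : ℝ) + q + 2 := by positivity
  have hx : x ≤ |c| + 1 := by
    have := le_abs_self c
    have := (abs_lt.mp h4).2
    linarith
  rw [div_lt_iff₀ (by positivity)] at hK
  have hd : ((p : ℝ) + q + 2) * |z - y| ≤ ε / 2 := by
    have hK1 : (0 : ℝ) < (K : ℝ) + 1 := by positivity
    have : ((K : ℝ) + 1) * (((p : ℝ) + q + 2) * |z - y|) ≤ ((K : ℝ) + 1) * (ε / 2) := by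
      calc ((K : ℝ) + 1) * (((p : ℝ) + q + 2) * |z - y|)
          = ((p : ℝ) + q + 2) * (((K : ℝ) + 1) * |z - y|) := by ring
        _ ≤ ((p : ℝ) + q + 2) * (|c| + 1) := by gcongr; linarith
        _ ≤ _ := by nlinarith
    exact le_of_mul_le_mul_left this hK1
  have key : ∀ w : ℝ, |(p + q + 2) * w - c| < ε → |w - c / (p + q + 2)| < ε := by
    intro w hw
    have e : (p + q + 2) * w - c = (p + q + 2) * (w - c / (p + q + 2)) := by
      field_simp
    rw [e, abs_mul, abs_of_pos hs] at hw
    nlinarith [abs_nonneg (w - c / (p + q + 2))]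
  have a1 := abs_lt.mp h3
  have a2 := abs_nonneg (z - y)
  have a3 := neg_abs_le (z - y)
  have a4 := le_abs_self (z - y)
  constructor
  · apply key
    have e : ((p : ℝ) + q + 2) * y - c = (x - c) - (p + 1) * (z - y) := by rw [f1]; ring
    rw [e, abs_lt]
    constructor <;> nlinarith
  · apply key
    have e : ((p : ℝ) + q + 2) * z - c = (x - c) + (q + 1) * (z - y) := by rw [f1]; ring
    rw [e, abs_lt]
    constructor <;> nlinarith

lemma eulerP_left (p q : ℕ) (c : ℝ) (h : eulerP p q c) :
    eulerP (p + 1) q (c / (p + q + 2)) := by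
  intro ε hε
  obtain ⟨M, hM⟩ := eulerP_core p q c h ε hε
  refine ⟨M + 1, fun i j hi hj => ?_⟩
  obtain ⟨j, rfl⟩ : ∃ k, j = k + 1 := ⟨j - 1, by omega⟩
  exact (hM i j (by omega) (by omega)).1

lemma eulerP_right (p q : ℕ) (c : ℝ) (h : eulerP p q c) :
    eulerP p (q + 1) (c / (p + q + 2)) := by
  intro ε hε
  obtain ⟨M, hM⟩ := eulerP_core p q c h ε hε
  refine ⟨M + 1, fun i j hi hj => ?_⟩
  obtain ⟨i, rfl⟩ : ∃ k, i = k + 1 := ⟨i - 1, by omega⟩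
  exact (hM i j (by omega) (by omega)).2

lemma eulerP_zero : eulerP 0 0 1 := by
  intro ε hε
  refine ⟨0, fun i j _ _ => ?_⟩
  have hE : (eulerA 0 0 i j : ℝ) ≠ 0 := by
    exact_mod_cast (eulerA_pos _ _ _ _).ne'
  simp [eulerH, div_self hE, hε]

lemma euler_fact (p q : ℕ) : (1 : ℝ) / (Nat.factorial (p + q + 1)) / (p + q + 2)
    = 1 / (Nat.factorial (p + q + 1 + 1)) := by
  rw [Nat.factorial_succ (p + q + 1), div_div]
  push_cast
  congr 1
  ring

lemma eulerP_all (p q : ℕ) : eulerP p q (1 / (Nat.factorial (p + q + 1))) := by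
  induction p with
  | zero =>
    induction q with
    | zero => simpa using eulerP_zero
    | succ q ih =>
      have := eulerP_right 0 q _ ih
      rwa [euler_fact 0 q] at this
  | succ p ih =>
    have := eulerP_left p q _ ih
    rw [euler_fact p q] at this
    rwa [show p + 1 + q + 1 = p + q + 1 + 1 by ring]

theorem stmt12 (p q : ℕ) :
    ∀ ε : ℝ, 0 < ε → ∃ M : ℕ, ∀ i j : ℕ, M ≤ i → M ≤ j →
      |(eulerA p q i j : ℝ) / (eulerA 0 0 (p + i) (q + j)) -
          1 / (Nat.factorial (p + q + 1))| < ε := by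
  exact eulerP_all p q
end

section
/- Let p, q, i, j be nonnegative integers and let a_x, a_z, a_w, b_x, b_z, b_w be positive real numbers satisfying a_w = (q+2+j)·a_x + (p+2+i)·a_z and b_w = (q+1+j)·b_x + (p+2+i)·b_z. If b_z/b_x ≤ ((q+j)/(q+1+j))·(a_z/a_x), then a_w/b_w ≤ a_z/b_z and a_x/b_x ≤ ((q+1+j)/(q+2+j))·(a_w/b_w). -/
theorem stmt14 (p q i j : ℕ) (ax az aw bx bz bw : ℝ)
    (hax : 0 < ax) (haz : 0 < az) (haw : 0 < aw)
    (hbx : 0 < bx) (hbz : 0 < bz) (hbw : 0 < bw)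
    (ha : aw = ((q : ℝ) + 2 + j) * ax + ((p : ℝ) + 2 + i) * az)
    (hb : bw = ((q : ℝ) + 1 + j) * bx + ((p : ℝ) + 2 + i) * bz)
    (h : bz / bx ≤ (((q : ℝ) + j) / ((q : ℝ) + 1 + j)) * (az / ax)) :
    aw / bw ≤ az / bz ∧ ax / bx ≤ (((q : ℝ) + 1 + j) / ((q : ℝ) + 2 + j)) * (aw / bw) := by
  have hn : (0 : ℝ) ≤ (q : ℝ) + j := by positivity
  have hm : (0 : ℝ) ≤ (p : ℝ) + 2 + i := by positivity
  have e1 : (q : ℝ) + 1 + j = ((q : ℝ) + j) + 1 := by ring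
  have e2 : (q : ℝ) + 2 + j = ((q : ℝ) + j) + 2 := by ring
  rw [e1] at hb h ⊢
  rw [e2] at ha ⊢
  generalize (q : ℝ) + j = n at *
  generalize (p : ℝ) + 2 + i = m at *
  have h1 : bz * ((n + 1) * ax) ≤ (n * az) * bx := by
    rwa [div_mul_div_comm, div_le_div_iff₀ hbx (by positivity)] at h
  have key : (n + 2) * (ax * bz) ≤ (n + 1) * (az * bx) := by
    have hp : 0 < az * bx := by positivity
    have h2 : (n + 2) * (bz * ((n + 1) * ax)) ≤ (n + 2) * ((n * az) * bx) :=
      mul_le_mul_of_nonneg_left h1 (by linarith)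
    have h3 : (n + 1) * ((n + 2) * (ax * bz)) ≤ (n + 1) * ((n + 1) * (az * bx)) := by
      linarith
    exact le_of_mul_le_mul_left h3 (by linarith)
  constructor
  · rw [div_le_div_iff₀ hbw hbz, ha, hb]
    linarith
  · rw [div_mul_div_comm, div_le_div_iff₀ hbx (by positivity), ha, hb]
    have h4 := mul_le_mul_of_nonneg_left key hm
    linarith
end
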